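/- Let ν > -1 and let (B_n)_{n≥0} be the sequence of Bernoulli-Dunkl polynomials, i.e. the unique real polynomials with deg B_n = n satisfying, for every n ∈ ℕ and x ∈ ℝ, Σ_{k=0}^n binom_ν(n,k)·μ_{k,ν}·B_{n−k}(x) = x^n, where μ_{2k,ν} = (ν+1)/(k+ν+1), μ_{2k+1,ν} = 0, and binom_ν(n,k) = γ_{n,ν}/(γ_{k,ν}γ_{n−k,ν}). Then (ν+1)·∫_{−1}^1 B_n(x)|x|^{2ν+1} dx = δ_{n,0} for every n ∈ ℕ; in particular, for every n ≥ 1 with n even, ∫_0^1 B_n(x)·x^{2ν+1} dx = 0. -/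

import Mathlib

open Polynomial

noncomputable def gammaDunkl (ν : ℝ) (n : ℕ) : ℝ :=
  if Even n then 2 ^ n * (Nat.factorial (n / 2)) * (ascPochhammer ℝ (n / 2)).eval (ν + 1)
  else 2 ^ n * (Nat.factorial (n / 2)) * (ascPochhammer ℝ (n / 2 + 1)).eval (ν + 1)

noncomputable def binomDunkl (ν : ℝ) (n k : ℕ) : ℝ :=
  gammaDunkl ν n / (gammaDunkl ν k * gammaDunkl ν (n - k))

/-- The moments `μ_{2k,ν} = (ν+1)/(k+ν+1)`, `μ_{2k+1,ν} = 0` of the Bernoulli-Dunkl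
generating function `I_{ν+1}`. -/
noncomputable def bernoulliDunklMoment (ν : ℝ) (n : ℕ) : ℝ :=
  if Even n then (ν + 1) / ((n / 2 : ℕ) + ν + 1) else 0

lemma gammaDunkl_pos {ν : ℝ} (hν : -1 < ν) (n : ℕ) : 0 < gammaDunkl ν n := by
  have h : ∀ m, 0 < (ascPochhammer ℝ m).eval (ν + 1) :=
    fun m => ascPochhammer_pos m _ (by linarith)
  unfold gammaDunkl
  split_ifs
  · have := h (n / 2)
    positivity
  · have := h (n / 2 + 1)
    positivity

lemma gammaDunkl_zero (ν : ℝ) : gammaDunkl ν 0 = 1 := by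
  simp [gammaDunkl]

lemma binomDunkl_zero_right {ν : ℝ} (hν : -1 < ν) (n : ℕ) : binomDunkl ν n 0 = 1 := by
  simp [binomDunkl, gammaDunkl_zero, (gammaDunkl_pos hν n).ne']

lemma binomDunkl_self {ν : ℝ} (hν : -1 < ν) (n : ℕ) : binomDunkl ν n n = 1 := by
  simp [binomDunkl, gammaDunkl_zero, (gammaDunkl_pos hν n).ne']

lemma bernoulliDunklMoment_zero {ν : ℝ} (hν : -1 < ν) : bernoulliDunklMoment ν 0 = 1 := by
  have : ν + 1 ≠ 0 := by linarith
  simp [bernoulliDunklMoment, this]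

lemma intervalIntegrable_mul_rpow {s : ℝ} (hs : -1 < s) {f : ℝ → ℝ} (hf : Continuous f)
    (a b : ℝ) : IntervalIntegrable (fun x => f x * x ^ s) MeasureTheory.volume a b :=
  (intervalIntegral.intervalIntegrable_rpow' hs).continuousOn_mul hf.continuousOn

lemma intervalIntegrable_mul_abs_rpow {s : ℝ} (hs : -1 < s) {f : ℝ → ℝ} (hf : Continuous f) :
    IntervalIntegrable (fun x => f x * |x| ^ s) MeasureTheory.volume 0 1 := by
  refine (intervalIntegrable_mul_rpow hs hf 0 1).congr ?_
  intro x hx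
  rw [Set.uIoc_of_le zero_le_one] at hx
  simp only [abs_of_pos hx.1]

lemma intervalIntegrable_mul_abs_rpow_neg {s : ℝ} (hs : -1 < s) {f : ℝ → ℝ}
    (hf : Continuous f) :
    IntervalIntegrable (fun x => f x * |x| ^ s) MeasureTheory.volume (-1) 0 := by
  have h := intervalIntegrable_mul_abs_rpow hs (hf.comp continuous_neg)
  rw [IntervalIntegrable.iff_comp_neg]
  simpa using h.symm

/-- Folding a weighted integral over `(-1, 1)` onto `(0, 1)`. -/
lemma setIntegral_mul_abs_rpow {s : ℝ} (hs : -1 < s) {f : ℝ → ℝ} (hf : Continuous f) :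
    ∫ x in Set.Ioo (-1 : ℝ) 1, f x * |x| ^ s = ∫ x in (0 : ℝ)..1, (f x + f (-x)) * x ^ s := by
  have hpos : ∀ g : ℝ → ℝ, ∫ x in (0 : ℝ)..1, g x * |x| ^ s = ∫ x in (0 : ℝ)..1, g x * x ^ s := by
    intro g
    refine intervalIntegral.integral_congr fun x hx => ?_
    rw [Set.uIcc_of_le zero_le_one] at hx
    simp only [abs_of_nonneg hx.1]
  have hneg : ∫ x in (-1 : ℝ)..0, f x * |x| ^ s = ∫ x in (0 : ℝ)..1, f (-x) * |x| ^ s := by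
    have := intervalIntegral.integral_comp_neg (a := 0) (b := 1) fun x : ℝ => f x * |x| ^ s
    simpa using this.symm
  rw [← MeasureTheory.integral_Ioc_eq_integral_Ioo,
    ← intervalIntegral.integral_of_le (by norm_num : (-1 : ℝ) ≤ 1),
    ← intervalIntegral.integral_add_adjacent_intervals
      (intervalIntegrable_mul_abs_rpow_neg hs hf) (intervalIntegrable_mul_abs_rpow hs hf),
    hneg, hpos f, hpos fun x => f (-x),
    ← intervalIntegral.integral_add
      (intervalIntegrable_mul_rpow hs (f := fun x => f (-x)) (by fun_prop) 0 1)
      (intervalIntegrable_mul_rpow hs hf 0 1)]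
  simp only [add_mul, add_comm]

lemma integrableOn_mul_abs_rpow {s : ℝ} (hs : -1 < s) {f : ℝ → ℝ} (hf : Continuous f) :
    MeasureTheory.IntegrableOn (fun x => f x * |x| ^ s) (Set.Ioo (-1) 1) := by
  have h := (intervalIntegrable_mul_abs_rpow_neg hs hf).trans
    (intervalIntegrable_mul_abs_rpow hs hf)
  exact ((intervalIntegrable_iff_integrableOn_Ioc_of_le (by norm_num)).1 h).mono_set
    Set.Ioo_subset_Ioc_self

lemma integral_pow_mul_rpow {s : ℝ} (hs : -1 < s) (n : ℕ) :
    ∫ x in (0 : ℝ)..1, x ^ n * x ^ s = 1 / (n + s + 1) := by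
  have hn : (0 : ℝ) ≤ n := n.cast_nonneg
  have h : ∫ x in (0 : ℝ)..1, x ^ n * x ^ s = ∫ x in (0 : ℝ)..1, x ^ ((n : ℝ) + s) := by
    refine intervalIntegral.integral_congr_uIoo fun x hx => ?_
    rw [Set.uIoo_of_le zero_le_one] at hx
    simp only [Real.rpow_add hx.1, Real.rpow_natCast]
  rw [h, integral_rpow (Or.inl (by linarith)), Real.one_rpow,
    Real.zero_rpow (by linarith), sub_zero]

/-- The numbers `bernoulliDunklMoment ν n` are the moments of `(ν + 1) |x| ^ (2 ν + 1)` on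
`(-1, 1)`. -/
lemma integral_pow_eq_bernoulliDunklMoment {ν : ℝ} (hν : -1 < ν) (n : ℕ) :
    (ν + 1) * ∫ x in Set.Ioo (-1 : ℝ) 1, x ^ n * |x| ^ (2 * ν + 1) =
      bernoulliDunklMoment ν n := by
  have hs : -1 < 2 * ν + 1 := by linarith
  rw [setIntegral_mul_abs_rpow hs (continuous_pow n), bernoulliDunklMoment]
  split_ifs with hn
  · obtain ⟨k, rfl⟩ := hn
    have hk : (0 : ℝ) ≤ k := k.cast_nonneg
    have hdiv : (k + k) / 2 = k := by omega
    have h : ∀ x : ℝ, (x ^ (k + k) + (-x) ^ (k + k)) * x ^ (2 * ν + 1) =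
        2 * (x ^ (k + k) * x ^ (2 * ν + 1)) := fun x => by
      rw [Even.neg_pow ⟨k, rfl⟩]; ring
    simp only [h]
    rw [intervalIntegral.integral_const_mul, integral_pow_mul_rpow hs, hdiv]
    have h1 : (k : ℝ) + ν + 1 ≠ 0 := by linarith
    have h2 : ((k + k : ℕ) : ℝ) + (2 * ν + 1) + 1 = 2 * (k + ν + 1) := by push_cast; ring
    rw [h2]
    field_simp
  · simp [(Nat.not_even_iff_odd.1 hn).neg_pow]

/-- Isolating the leading term of the recurrence defining the Bernoulli-Dunkl polynomials. -/
lemma sum_binomDunkl_succ {ν : ℝ} (hν : -1 < ν) (n : ℕ) (a : ℕ → ℝ) :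
    ∑ k ∈ Finset.range (n + 1), binomDunkl ν n k * bernoulliDunklMoment ν k * a (n - k) =
      (∑ k ∈ Finset.range n,
        binomDunkl ν n (k + 1) * bernoulliDunklMoment ν (k + 1) * a (n - (k + 1))) + a n := by
  rw [Finset.sum_range_succ', binomDunkl_zero_right hν, bernoulliDunklMoment_zero hν]
  simp

/-- A Bernoulli-Dunkl polynomial has the parity of its index. -/
lemma bernoulliDunkl_eval_neg {ν : ℝ} (hν : -1 < ν) {B : ℕ → Polynomial ℝ}
    (hB : ∀ (n : ℕ) (x : ℝ),
      (∑ k ∈ Finset.range (n + 1),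
        binomDunkl ν n k * bernoulliDunklMoment ν k * (B (n - k)).eval x) = x ^ n)
    (n : ℕ) (x : ℝ) : (B n).eval (-x) = (-1) ^ n * (B n).eval x := by
  induction n using Nat.strong_induction_on with
  | _ n ih =>
    have h1 := hB n (-x)
    have h2 := hB n x
    rw [sum_binomDunkl_succ hν n fun m => (B m).eval (-x)] at h1
    rw [sum_binomDunkl_succ hν n fun m => (B m).eval x] at h2
    have h3 : ∑ k ∈ Finset.range n, binomDunkl ν n (k + 1) * bernoulliDunklMoment ν (k + 1) *
          (B (n - (k + 1))).eval (-x) =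
        (-1) ^ n * ∑ k ∈ Finset.range n,
          binomDunkl ν n (k + 1) * bernoulliDunklMoment ν (k + 1) *
            (B (n - (k + 1))).eval x := by
      rw [Finset.mul_sum]
      refine Finset.sum_congr rfl fun k hk => ?_
      rw [Finset.mem_range] at hk
      rw [ih _ (by omega)]
      by_cases hk2 : Even (k + 1)
      · have : (-1 : ℝ) ^ n = (-1) ^ (n - (k + 1)) := by
          conv_lhs => rw [← Nat.sub_add_cancel (show k + 1 ≤ n by omega), pow_add,
            hk2.neg_one_pow, mul_one]
        rw [this]
        ring
      · simp [bernoulliDunklMoment, hk2]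
    rw [neg_pow] at h1
    linear_combination h1 - h3 - (-1) ^ n * h2

/-- A sequence obeying the recurrence satisfied by the moments is `1, 0, 0, …`. -/
lemma eq_ite_of_sum_binomDunkl {ν : ℝ} (hν : -1 < ν) {a : ℕ → ℝ}
    (ha : ∀ n, ∑ k ∈ Finset.range (n + 1),
      binomDunkl ν n k * bernoulliDunklMoment ν k * a (n - k) = bernoulliDunklMoment ν n)
    (n : ℕ) : a n = if n = 0 then 1 else 0 := by
  induction n using Nat.strong_induction_on with
  | _ n ih =>
    have h := ha n
    rw [sum_binomDunkl_succ hν] at h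
    cases n with
    | zero => simpa [bernoulliDunklMoment_zero hν] using h
    | succ m =>
      have h0 : ∑ k ∈ Finset.range m, binomDunkl ν (m + 1) (k + 1) *
          bernoulliDunklMoment ν (k + 1) * a (m + 1 - (k + 1)) = 0 := by
        refine Finset.sum_eq_zero fun k hk => ?_
        rw [Finset.mem_range] at hk
        rw [ih _ (by omega), if_neg (by omega), mul_zero]
      rw [Finset.sum_range_succ, h0, Nat.sub_self, ih 0 (by omega), if_pos rfl,
        binomDunkl_self hν] at h
      rw [if_neg (by omega)]
      linarith

theorem bernoulliDunkl_orthogonality (ν : ℝ) (hν : -1 < ν) (B : ℕ → Polynomial ℝ)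
    (hdeg : ∀ n, (B n).natDegree = n)
    (hB : ∀ (n : ℕ) (x : ℝ),
      (∑ k ∈ Finset.range (n + 1),
        binomDunkl ν n k * bernoulliDunklMoment ν k * (B (n - k)).eval x) = x ^ n) :
    (∀ n : ℕ,
      (ν + 1) * (∫ x in Set.Ioo (-1 : ℝ) 1, (B n).eval x * |x| ^ (2 * ν + 1))
        = if n = 0 then 1 else 0) ∧
    (∀ n : ℕ, 1 ≤ n → Even n →
      (∫ x in Set.Ioo (0 : ℝ) 1, (B n).eval x * x ^ (2 * ν + 1)) = 0) := by
  have hs : -1 < 2 * ν + 1 := by linarith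
  have main : ∀ n : ℕ,
      (ν + 1) * (∫ x in Set.Ioo (-1 : ℝ) 1, (B n).eval x * |x| ^ (2 * ν + 1))
        = if n = 0 then 1 else 0 := by
    refine eq_ite_of_sum_binomDunkl hν fun n => ?_
    rw [← integral_pow_eq_bernoulliDunklMoment hν n]
    simp only [← hB n, Finset.sum_mul]
    rw [MeasureTheory.integral_finsetSum, Finset.mul_sum]
    · refine Finset.sum_congr rfl fun k _ => ?_
      simp only [mul_assoc, MeasureTheory.integral_const_mul]
      ring
    · intro k _
      exact integrableOn_mul_abs_rpow hs
        (f := fun x => binomDunkl ν n k * bernoulliDunklMoment ν k * (B (n - k)).eval x)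
        (continuous_const.mul (B (n - k)).continuous)
  refine ⟨main, fun n hn he => ?_⟩
  have h := main n
  have h2 : ∀ x : ℝ, ((B n).eval x + (B n).eval (-x)) * x ^ (2 * ν + 1) =
      2 * ((B n).eval x * x ^ (2 * ν + 1)) := fun x => by
    rw [bernoulliDunkl_eval_neg hν hB, he.neg_one_pow]; ring
  rw [if_neg (by omega), setIntegral_mul_abs_rpow hs (B n).continuous] at h
  simp only [h2] at h
  rw [intervalIntegral.integral_const_mul, intervalIntegral.integral_of_le zero_le_one,
    MeasureTheory.integral_Ioc_eq_integral_Ioo] at h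
  have hν' : ν + 1 ≠ 0 := by linarith
  simpa [hν'] using h
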